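/- Let p > 3 be a prime. Then 2^{(9p-9)/2} * sum_{k=0}^{(p-3)/2} C((p-1)/2, 2k) * C(2k,k) * H_k / 4^k ≡ -3*(-1)^{(p-1)/2} * (2*q_p(2) + 11p*q_p(2)^2) (mod p^2), where the congruence is between rational numbers whose denominators are coprime to p. -/

import Mathlib

/-- The coefficient `C(n, 2k) C(2k, k) / 4 ^ k`. -/
def trinomialTerm (n k : ℕ) : ℚ := (n.choose (2 * k) : ℚ) * ((2 * k).choose k : ℚ) / 4 ^ k

theorem trinomialTerm_eq_zero {n k : ℕ} (h : n < 2 * k) : trinomialTerm n k = 0 := by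
  simp [trinomialTerm, Nat.choose_eq_zero_of_lt h]

theorem choose_succ_right_mul (n k : ℕ) :
    (n.choose (k + 1) : ℚ) * (k + 1) = n.choose k * (n - k) := by
  rcases le_or_gt k n with h | h
  · have := Nat.choose_succ_right_eq n k
    rw [← Nat.cast_sub h]
    exact_mod_cast this
  · simp [Nat.choose_eq_zero_of_lt h, Nat.choose_eq_zero_of_lt (h.trans (Nat.lt_succ_self k))]

theorem trinomialTerm_succ_right (n k : ℕ) :
    4 * ((k : ℚ) + 1) ^ 2 * trinomialTerm n (k + 1) =
      (n - 2 * k) * (n - 2 * k - 1) * trinomialTerm n k := by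
  have h₁ := choose_succ_right_mul n (2 * k)
  have h₂ := choose_succ_right_mul n (2 * k + 1)
  have h₃ : ((k : ℚ) + 1) * ((2 * (k + 1)).choose (k + 1) : ℚ) =
      2 * (2 * k + 1) * ((2 * k).choose k : ℚ) := by
    exact_mod_cast Nat.succ_mul_centralBinom_succ k
  have hk : (2 * (k : ℚ) + 1) ≠ 0 := by positivity
  unfold trinomialTerm
  rw [show 2 * k + 1 + 1 = 2 * (k + 1) by ring] at h₂
  push_cast at h₁ h₂
  rw [pow_succ (4 : ℚ), div_eq_mul_inv, div_eq_mul_inv, mul_inv]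
  apply mul_left_cancel₀ hk
  linear_combination ((4 : ℚ) ^ k)⁻¹ *
    ((2 * (k : ℚ) + 1) * (k + 1) * (n.choose (2 * (k + 1)) : ℚ) * h₃ +
      (2 * k + 1) ^ 2 * ((2 * k).choose k : ℚ) * h₂ +
      (2 * k + 1) * ((2 * k).choose k : ℚ) * (n - 2 * k - 1) * h₁)

theorem trinomialTerm_succ_left (n k : ℕ) :
    ((n : ℚ) + 1) * trinomialTerm (n + 1) (k + 1) =
      (n + 2 * k + 3) * trinomialTerm n (k + 1) + (n - 2 * k) * trinomialTerm n k := by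
  have h := trinomialTerm_succ_right n k
  have h₁ := choose_succ_right_mul n (2 * k)
  have h₃ : ((k : ℚ) + 1) * ((2 * (k + 1)).choose (k + 1) : ℚ) =
      2 * (2 * k + 1) * ((2 * k).choose k : ℚ) := by
    exact_mod_cast Nat.succ_mul_centralBinom_succ k
  have h₄ : ((n + 1).choose (2 * (k + 1)) : ℚ) =
      n.choose (2 * k + 1) + n.choose (2 * (k + 1)) := by
    exact_mod_cast Nat.choose_succ_succ n (2 * k + 1)
  have hk : ((k : ℚ) + 1) ≠ 0 := by positivity
  have h₅ : 2 * ((k : ℚ) + 1) * (trinomialTerm (n + 1) (k + 1) - trinomialTerm n (k + 1)) =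
      (n - 2 * k) * trinomialTerm n k := by
    unfold trinomialTerm
    rw [h₄, pow_succ, div_eq_mul_inv, div_eq_mul_inv, div_eq_mul_inv, mul_inv]
    push_cast at h₁
    linear_combination ((4 : ℚ) ^ k)⁻¹ *
      (1 / 2 * (n.choose (2 * k + 1) : ℚ) * h₃ + ((2 * k).choose k : ℚ) * h₁)
  apply mul_left_cancel₀ (pow_ne_zero 2 hk)
  linear_combination ((k : ℚ) + 1) / 2 * (n + 1) * h₅ - (k + 1) / 2 * h

theorem sum_trinomialTerm_succ (n K : ℕ) :
    ((n : ℚ) + 1) * ∑ k ∈ Finset.range (K + 1), trinomialTerm (n + 1) k =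
      (2 * n + 1) * ∑ k ∈ Finset.range (K + 1), trinomialTerm n k
        - (n - 2 * K) * trinomialTerm n K := by
  induction K with
  | zero => simp [trinomialTerm]; ring
  | succ K ih =>
    rw [Finset.sum_range_succ, Finset.sum_range_succ _ (K + 1)]
    push_cast
    linear_combination ih + trinomialTerm_succ_left n K

theorem sum_trinomialTerm_mul_harmonic_succ (n K : ℕ) :
    ((n : ℚ) + 1) * ∑ k ∈ Finset.range (K + 1), trinomialTerm (n + 1) k * harmonic k =
      (2 * n + 1) * ∑ k ∈ Finset.range (K + 1), trinomialTerm n k * harmonic k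
        + ∑ k ∈ Finset.range K, (n - 2 * k) * trinomialTerm n k / (k + 1)
        - (n - 2 * K) * trinomialTerm n K * harmonic K := by
  induction K with
  | zero => simp
  | succ K ih =>
    rw [Finset.sum_range_succ _ (K + 1), Finset.sum_range_succ _ (K + 1),
      Finset.sum_range_succ (fun k : ℕ => ((n : ℚ) - 2 * k) * trinomialTerm n k / (k + 1)) K]
    have h := trinomialTerm_succ_left n K
    have hH := harmonic_succ K
    push_cast at hH ⊢
    rw [div_eq_mul_inv]
    linear_combination ih + harmonic (K + 1) * h + (n - 2 * K) * trinomialTerm n K * hH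

theorem sum_sub_mul_trinomialTerm_div (n K : ℕ) :
    ((n : ℚ) + 1) * ∑ k ∈ Finset.range K, (n - 2 * k) * trinomialTerm n k / (k + 1) =
      2 * n * ∑ k ∈ Finset.range K, trinomialTerm n k + 4 * K * trinomialTerm n K := by
  induction K with
  | zero => simp
  | succ K ih =>
    rw [Finset.sum_range_succ, Finset.sum_range_succ]
    have h := trinomialTerm_succ_right n K
    have hk : ((K : ℚ) + 1) ≠ 0 := by positivity
    have h' : 4 * ((K : ℚ) + 1) * trinomialTerm n (K + 1) =
        (n - 2 * K) * (n - 2 * K - 1) * trinomialTerm n K / (K + 1) := by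
      field_simp; linear_combination h
    push_cast
    rw [mul_add, ih, h']
    field_simp
    ring

theorem sum_trinomialTerm (n K : ℕ) (h : n < 2 * K) :
    ∑ k ∈ Finset.range K, trinomialTerm n k = n.centralBinom / 2 ^ n := by
  obtain ⟨K, rfl⟩ : ∃ m, K = m + 1 := ⟨K - 1, by omega⟩
  induction n with
  | zero =>
    rw [Finset.sum_range_succ']
    rw [Finset.sum_eq_zero fun k _ => trinomialTerm_eq_zero (by omega)]
    simp [trinomialTerm]
  | succ n ih =>
    have h₀ : ((n : ℚ) - 2 * K) * trinomialTerm n K = 0 := by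
      rcases (show n ≤ 2 * K by omega).lt_or_eq with h | h
      · simp [trinomialTerm_eq_zero h]
      · simp [h]
    have h₁ := sum_trinomialTerm_succ n K
    have h₂ : ((n : ℚ) + 1) * ((n + 1).centralBinom : ℚ) = 2 * (2 * n + 1) * n.centralBinom := by
      exact_mod_cast Nat.succ_mul_centralBinom_succ n
    rw [h₀, ih (by omega), sub_zero] at h₁
    apply mul_left_cancel₀ (show (n : ℚ) + 1 ≠ 0 by positivity)
    rw [h₁, ← mul_div_assoc, ← mul_div_assoc, h₂, pow_succ]
    field_simp

theorem sum_trinomialTerm_mul_harmonic (n K : ℕ) (h : n < 2 * K) :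
    ∑ k ∈ Finset.range K, trinomialTerm n k * harmonic k =
      n.centralBinom / 2 ^ n * (3 * harmonic n - 2 * harmonic (2 * n)) := by
  obtain ⟨K, rfl⟩ : ∃ m, K = m + 1 := ⟨K - 1, by omega⟩
  induction n with
  | zero =>
    rw [Finset.sum_range_succ']
    rw [Finset.sum_eq_zero fun k _ => by rw [trinomialTerm_eq_zero (by omega), zero_mul]]
    simp
  | succ n ih =>
    have h₀ : ((n : ℚ) - 2 * K) * trinomialTerm n K = 0 := by
      rcases (show n ≤ 2 * K by omega).lt_or_eq with h | h
      · simp [trinomialTerm_eq_zero h]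
      · simp [h]
    have h₁ := sum_trinomialTerm_mul_harmonic_succ n K
    have h₂ := sum_trinomialTerm_succ n K
    have h₃ := sum_sub_mul_trinomialTerm_div n (K + 1)
    rw [Finset.sum_range_succ, h₀, zero_div, add_zero,
      trinomialTerm_eq_zero (show n < 2 * (K + 1) by omega), mul_zero, add_zero] at h₃
    rw [ih (by omega), h₀, zero_mul, sub_zero] at h₁
    rw [h₀, sub_zero, sum_trinomialTerm (n + 1) _ h] at h₂
    rw [← sum_trinomialTerm n (K + 1) (by omega)] at h₁
    rw [show 2 * (n + 1) = 2 * n + 1 + 1 by ring, harmonic_succ, harmonic_succ, harmonic_succ]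
    have hn : (n : ℚ) + 1 ≠ 0 := by positivity
    have hn' : 2 * (n : ℚ) + 1 ≠ 0 := by positivity
    have h₄ : ∑ k ∈ Finset.range (K + 1), trinomialTerm n k =
        ((n + 1 : ℕ).centralBinom : ℚ) / 2 ^ (n + 1) * (n + 1) / (2 * n + 1) := by
      field_simp at h₂ ⊢
      linear_combination -h₂
    rw [h₄] at h₁ h₃
    have h₅ : ∑ k ∈ Finset.range K, ((n : ℚ) - 2 * k) * trinomialTerm n k / (k + 1) =
        2 * n * (((n + 1 : ℕ).centralBinom : ℚ) / 2 ^ (n + 1) / (2 * n + 1)) := by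
      apply mul_left_cancel₀ hn
      rw [h₃]
      ring
    rw [h₅] at h₁
    apply mul_left_cancel₀ hn
    rw [h₁]
    push_cast
    have hn'' : 2 * (n : ℚ) + 1 + 1 ≠ 0 := by positivity
    rw [show 2 * (n : ℚ) + 1 + 1 = 2 * (n + 1) by ring]
    field_simp
    ring

/-- The rational numbers whose denominators are coprime to `p`. -/
noncomputable def ratPadicInt (p : ℕ) [Fact p.Prime] : Subring ℚ :=
  (PadicInt.subring p).comap (Rat.castHom ℚ_[p])

section

variable {p : ℕ} [Fact p.Prime]

theorem mem_ratPadicInt {x : ℚ} : x ∈ ratPadicInt p ↔ ‖(x : ℚ_[p])‖ ≤ 1 := Iff.rfl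

@[simp, norm_cast]
theorem coe_ofNat_ratPadicInt (m : ℕ) [m.AtLeastTwo] :
    ((ofNat(m) : ratPadicInt p) : ℚ) = ofNat(m) :=
  map_ofNat (ratPadicInt p).subtype m

theorem inv_natCast_mem_ratPadicInt {j : ℕ} (h₀ : j ≠ 0) (h : j < p) :
    (j : ℚ)⁻¹ ∈ ratPadicInt p := by
  have hj : ‖(j : ℚ_[p])‖ = 1 :=
    Padic.norm_natCast_eq_one_iff.2
      (Nat.coprime_of_lt_prime h₀ h (Fact.out : p.Prime))
  rw [mem_ratPadicInt]
  simp [hj]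

theorem pow_dvd_num_of_eq_mul (s : ℕ) {x : ℚ} (y : ratPadicInt p) (h : x = (p : ℚ) ^ s * y) :
    (p : ℤ) ^ s ∣ x.num := by
  have hy : ‖((y : ℚ) : ℚ_[p])‖ ≤ 1 := y.2
  have hx : ((x.num : ℤ) : ℚ_[p]) = (p : ℚ_[p]) ^ s * ((y : ℚ) : ℚ_[p]) * (x.den : ℚ_[p]) := by
    have : (x.num : ℚ) = (p : ℚ) ^ s * y * x.den := by rw [← h, Rat.mul_den_eq_num]
    exact_mod_cast congrArg (Rat.cast : ℚ → ℚ_[p]) this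
  have hd : ‖(x.den : ℚ_[p])‖ ≤ 1 := by simpa using Padic.norm_int_le_one (p := p) x.den
  have := (Padic.norm_int_le_pow_iff_dvd (p := p) x.num s).1 (by
    rw [hx, norm_mul, norm_mul, Padic.norm_p_pow]
    have hp : (0 : ℝ) ≤ (p : ℝ) ^ (-s : ℤ) := by positivity
    calc _ ≤ (p : ℝ) ^ (-s : ℤ) * 1 * 1 := by gcongr
      _ = _ := by ring)
  exact_mod_cast this

theorem harmonic_mem_ratPadicInt {n : ℕ} (h : n < p) : harmonic n ∈ ratPadicInt p :=
  sum_mem fun j hj => by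
    have := Finset.mem_range.1 hj
    exact inv_natCast_mem_ratPadicInt j.succ_ne_zero (by omega)

theorem exists_two_pow_eq (h : p ≠ 2) : ∃ q : ratPadicInt p, (2 : ℚ) ^ (p - 1) = 1 + p * q := by
  have h2 : ((2 : ℤ) : ZMod p) ≠ 0 := by
    intro h0
    rw [ZMod.intCast_zmod_eq_zero_iff_dvd] at h0
    have := (Nat.prime_dvd_prime_iff_eq (Fact.out : p.Prime) Nat.prime_two).1 (by exact_mod_cast h0)
    exact h this
  have := ZMod.pow_card_sub_one_eq_one h2
  have h3 : (((2 : ℤ) ^ (p - 1) - 1 : ℤ) : ZMod p) = 0 := by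
    push_cast at this ⊢
    rw [this, sub_self]
  obtain ⟨a, ha⟩ := (ZMod.intCast_zmod_eq_zero_iff_dvd _ _).1 h3
  refine ⟨(a : ratPadicInt p), ?_⟩
  have : (2 : ℚ) ^ (p - 1) - 1 = p * a := by exact_mod_cast ha
  push_cast
  linear_combination this

theorem exists_inv_sq_eq {j : ℕ} (h₀ : j ≠ 0) (h : j < p) (hp : 3 ≤ p) :
    ∃ a : ratPadicInt p, ((j : ℚ)⁻¹) ^ 2 = j ^ (p - 3) + p * a := by
  have hj : (j : ZMod p) ≠ 0 := by
    rw [Ne, ZMod.natCast_eq_zero_iff]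
    exact Nat.not_dvd_of_pos_of_lt (Nat.pos_of_ne_zero h₀) h
  have h3 : (((j : ℤ) ^ (p - 1) - 1 : ℤ) : ZMod p) = 0 := by
    push_cast
    rw [ZMod.pow_card_sub_one_eq_one hj, sub_self]
  obtain ⟨a, ha⟩ := (ZMod.intCast_zmod_eq_zero_iff_dvd _ _).1 h3
  have ha' : (j : ℚ) ^ (p - 1) - 1 = p * a := by exact_mod_cast ha
  refine ⟨-(a : ratPadicInt p) * ⟨_, inv_natCast_mem_ratPadicInt h₀ h⟩ ^ 2, ?_⟩
  have hj' : (j : ℚ) ≠ 0 := by exact_mod_cast h₀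
  rw [show p - 1 = p - 3 + 2 by omega, pow_add] at ha'
  push_cast
  field_simp
  linear_combination -ha'

theorem sum_range_pow_eq_zero {n : ℕ} (hn : p = 2 * n + 1) (h : 2 ≤ n) :
    ∑ j ∈ Finset.range n, ((j + 1 : ℕ) : ZMod p) ^ (p - 3) = 0 := by
  have hp : ((2 * n + 1 : ℕ) : ZMod p) = 0 := by rw [← hn]; simp
  have h₁ : ∑ x : ZMod p, x ^ (p - 3) = 0 :=
    FiniteField.sum_pow_lt_card_sub_one (ZMod p) _ (by rw [ZMod.card]; omega)
  have h₂ : ∑ x : ZMod p, x ^ (p - 3) = ∑ j ∈ Finset.range p, (j : ZMod p) ^ (p - 3) := by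
    symm
    refine Finset.sum_bij (fun j _ => (j : ZMod p)) (by simp) ?_ ?_ (by simp)
    · intro a ha b hb hab
      rw [ZMod.natCast_eq_natCast_iff] at hab
      exact Nat.ModEq.eq_of_lt_of_lt hab (Finset.mem_range.1 ha) (Finset.mem_range.1 hb)
    · intro b _
      exact ⟨b.val, Finset.mem_range.2 (ZMod.val_lt b), by simp⟩
  have h₃ : Finset.range p = Finset.range (n + n + 1) := by rw [hn, two_mul]
  rw [h₂, h₃, Finset.sum_range_succ', Finset.sum_range_add,
    ← Finset.sum_range_reflect (fun j => ((n + j + 1 : ℕ) : ZMod p) ^ (p - 3)),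
    Nat.cast_zero, zero_pow (by omega), add_zero] at h₁
  have h₄ : ∀ j ∈ Finset.range n, ((n + (n - 1 - j) + 1 : ℕ) : ZMod p) ^ (p - 3) =
      ((j + 1 : ℕ) : ZMod p) ^ (p - 3) := by
    intro j hj
    have := Finset.mem_range.1 hj
    have he : Even (p - 3) := ⟨n - 1, by omega⟩
    rw [← he.neg_pow]
    congr 1
    apply neg_eq_of_add_eq_zero_left
    rw [← Nat.cast_add, ← hp]
    congr 1
    omega
  rw [Finset.sum_congr rfl h₄, ← two_mul] at h₁
  refine (mul_eq_zero.1 h₁).resolve_left ?_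
  rw [show (2 : ZMod p) = ((2 : ℕ) : ZMod p) by simp, ZMod.natCast_eq_zero_iff]
  exact Nat.not_dvd_of_pos_of_lt two_pos (by omega)

theorem exists_sum_inv_sq_eq {n : ℕ} (hn : p = 2 * n + 1) (h : 2 ≤ n) :
    ∃ a : ratPadicInt p, ∑ j ∈ Finset.range n, (((j + 1 : ℕ) : ℚ)⁻¹) ^ 2 = p * a := by
  have h₀ := sum_range_pow_eq_zero hn h
  obtain ⟨a, ha⟩ : p ∣ ∑ j ∈ Finset.range n, (j + 1) ^ (p - 3) := by
    rw [← ZMod.natCast_eq_zero_iff]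
    exact_mod_cast h₀
  have h₁ : ∀ j : ℕ, ∃ b : ratPadicInt p, j ∈ Finset.range n →
      (((j + 1 : ℕ) : ℚ)⁻¹) ^ 2 = ((j + 1 : ℕ) : ℚ) ^ (p - 3) + p * b := by
    intro j
    by_cases hj : j < n
    · obtain ⟨b, hb⟩ := exists_inv_sq_eq (p := p) j.succ_ne_zero (by omega) (by omega)
      exact ⟨b, fun _ => hb⟩
    · exact ⟨0, fun h => absurd (Finset.mem_range.1 h) hj⟩
  choose b hb using h₁
  refine ⟨a + ∑ j ∈ Finset.range n, b j, ?_⟩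
  rw [Finset.sum_congr rfl hb, Finset.sum_add_distrib, ← Finset.mul_sum]
  have : ∑ j ∈ Finset.range n, ((j + 1 : ℕ) : ℚ) ^ (p - 3) = p * a := by exact_mod_cast ha
  rw [this]
  push_cast
  ring

/-- A form of Wolstenholme's theorem. -/
theorem exists_harmonic_two_mul_eq {n : ℕ} (hn : p = 2 * n + 1) (h : 2 ≤ n) :
    ∃ a : ratPadicInt p, harmonic (2 * n) = p ^ 2 * a := by
  obtain ⟨a, ha⟩ := exists_sum_inv_sq_eq hn h
  have h₁ : ∀ j : ℕ, ∃ b : ratPadicInt p, j ∈ Finset.range n →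
      ((j + 1 : ℕ) : ℚ)⁻¹ + ((n + (n - 1 - j) + 1 : ℕ) : ℚ)⁻¹ =
        -p * (((j + 1 : ℕ) : ℚ)⁻¹) ^ 2 + p ^ 2 * b := by
    intro j
    by_cases hj : j < n
    · refine ⟨⟨_, inv_natCast_mem_ratPadicInt j.succ_ne_zero (by omega)⟩ ^ 2 *
        ⟨_, inv_natCast_mem_ratPadicInt (n + (n - 1 - j)).succ_ne_zero (by omega)⟩, fun _ => ?_⟩
      have hx : ((j + 1 : ℕ) : ℚ) ≠ 0 := by positivity
      have hy : ((n + (n - 1 - j) + 1 : ℕ) : ℚ) ≠ 0 := by positivity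
      have hs : (p : ℚ) = ((j + 1 : ℕ) : ℚ) + ((n + (n - 1 - j) + 1 : ℕ) : ℚ) := by
        rw [← Nat.cast_add]
        congr 1
        omega
      simp only [Subring.coe_mul, Subring.coe_pow, Nat.succ_eq_add_one]
      rw [hs]
      generalize ((j + 1 : ℕ) : ℚ) = x at *
      generalize ((n + (n - 1 - j) + 1 : ℕ) : ℚ) = y at *
      field_simp
      ring
    · exact ⟨0, fun h => absurd (Finset.mem_range.1 h) hj⟩
  choose b hb using h₁
  refine ⟨-a + ∑ j ∈ Finset.range n, b j, ?_⟩
  rw [harmonic, two_mul, Finset.sum_range_add,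
    ← Finset.sum_range_reflect (fun j => ((n + j + 1 : ℕ) : ℚ)⁻¹), ← Finset.sum_add_distrib,
    Finset.sum_congr rfl hb, Finset.sum_add_distrib, ← Finset.mul_sum, ← Finset.mul_sum, ha]
  push_cast
  ring

theorem exists_prod_one_sub_eq (hp : p ≠ 2) (c : ratPadicInt p) {m : ℕ} (h : m < p) :
    ∃ r : ratPadicInt p, ∏ j ∈ Finset.range m, (1 - c * p * ((j + 1 : ℕ) : ℚ)⁻¹) =
      1 - c * p * harmonic m +
        (c * p) ^ 2 * (harmonic m ^ 2 - ∑ j ∈ Finset.range m, (((j + 1 : ℕ) : ℚ)⁻¹) ^ 2) / 2 +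
        p ^ 3 * r := by
  induction m with
  | zero => exact ⟨0, by simp⟩
  | succ m ih =>
    obtain ⟨r, hr⟩ := ih (by omega)
    have h2 : 2 < p := lt_of_le_of_ne (Fact.out : p.Prime).two_le hp.symm
    let x : ratPadicInt p := ⟨_, inv_natCast_mem_ratPadicInt m.succ_ne_zero h⟩
    let t : ratPadicInt p := ⟨_, inv_natCast_mem_ratPadicInt two_ne_zero h2⟩
    let H : ratPadicInt p := ⟨_, harmonic_mem_ratPadicInt (Nat.lt_of_succ_lt h)⟩
    let S : ratPadicInt p := ⟨∑ j ∈ Finset.range m, (((j + 1 : ℕ) : ℚ)⁻¹) ^ 2,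
      sum_mem fun j hj => pow_mem (inv_natCast_mem_ratPadicInt j.succ_ne_zero (by
        have := Finset.mem_range.1 hj
        omega)) 2⟩
    refine ⟨r * (1 - c * p * x) - c ^ 3 * x * (H ^ 2 - S) * t, ?_⟩
    rw [Finset.prod_range_succ, Finset.sum_range_succ, harmonic_succ, hr]
    simp only [x, t, H, S, Nat.succ_eq_add_one]
    push_cast
    ring

end

theorem choose_eq_prod (M m : ℕ) :
    (M.choose m : ℚ) =
      (-1) ^ m * ∏ j ∈ Finset.range m, (1 - ((M : ℚ) + 1) * ((j + 1 : ℕ) : ℚ)⁻¹) := by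
  induction m with
  | zero => simp
  | succ m ih =>
    have h := choose_succ_right_mul M m
    have hm : (m : ℚ) + 1 ≠ 0 := by positivity
    rw [Finset.prod_range_succ, pow_succ]
    apply mul_right_cancel₀ hm
    rw [h, ih]
    push_cast
    field_simp
    ring

theorem centralBinom_eq_prod (n : ℕ) :
    (n.centralBinom : ℚ) =
      4 ^ n * ∏ j ∈ Finset.range n, ((2 * j + 1 : ℕ) : ℚ) * (2 * ((j + 1 : ℕ) : ℚ))⁻¹ := by
  induction n with
  | zero => simp
  | succ n ih =>
    have h : ((n : ℚ) + 1) * ((n + 1).centralBinom : ℚ) = 2 * (2 * n + 1) * n.centralBinom := by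
      exact_mod_cast Nat.succ_mul_centralBinom_succ n
    have hn : (n : ℚ) + 1 ≠ 0 := by positivity
    rw [Finset.prod_range_succ, pow_succ]
    apply mul_left_cancel₀ hn
    rw [h, ih]
    push_cast
    field_simp
    ring

theorem centralBinom_eq_prod_one_sub (n : ℕ) :
    (n.centralBinom : ℚ) = (-1) ^ n * 4 ^ n *
      ∏ j ∈ Finset.range n, (1 - 2⁻¹ * (2 * (n : ℚ) + 1) * ((j + 1 : ℕ) : ℚ)⁻¹) := by
  rw [centralBinom_eq_prod, Finset.prod_mul_distrib,
    ← Finset.prod_range_reflect (fun j => ((2 * j + 1 : ℕ) : ℚ)), ← Finset.prod_mul_distrib,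
    mul_comm ((-1 : ℚ) ^ n), mul_assoc]
  congr 1
  rw [show (-1 : ℚ) ^ n = ∏ _j ∈ Finset.range n, (-1 : ℚ) by simp, ← Finset.prod_mul_distrib]
  refine Finset.prod_congr rfl fun j hj => ?_
  have hj := Finset.mem_range.1 hj
  have h : ((2 * (n - 1 - j) + 1 : ℕ) : ℚ) = 2 * n - 2 * j - 1 := by
    have : 2 * (n - 1 - j) + 1 + (2 * j + 1) = 2 * n := by omega
    have : ((2 * (n - 1 - j) + 1 + (2 * j + 1) : ℕ) : ℚ) = ((2 * n : ℕ) : ℚ) := by rw [this]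
    push_cast at this ⊢
    linear_combination this
  rw [h]
  push_cast
  field_simp
  ring

theorem exists_harmonic_eq_and_centralBinom_eq {p n : ℕ} [Fact p.Prime] (hn : p = 2 * n + 1)
    (h : 2 ≤ n) (q : ratPadicInt p) (hq : (2 : ℚ) ^ (p - 1) = 1 + p * q) :
    (∃ v : ratPadicInt p, harmonic n = -2 * q + p * q ^ 2 + p ^ 2 * v) ∧
      ∃ z : ratPadicInt p, (n.centralBinom : ℚ) = (-1) ^ n * (1 + 2 * p * q + p ^ 2 * z) := by
  let t : ratPadicInt p := ⟨_, inv_natCast_mem_ratPadicInt two_ne_zero (by omega)⟩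
  have ht : (t : ℚ) = 1 / 2 := by simp [t]
  obtain ⟨s, hs⟩ := exists_sum_inv_sq_eq hn h
  obtain ⟨r₁, h₁⟩ := exists_prod_one_sub_eq (p := p) (by omega) 1 (m := n) (by omega)
  obtain ⟨r₂, h₂⟩ := exists_prod_one_sub_eq (p := p) (by omega) t (m := n) (by omega)
  obtain ⟨H, hH⟩ : ∃ H : ratPadicInt p, (H : ℚ) = harmonic n :=
    ⟨⟨_, harmonic_mem_ratPadicInt (by omega)⟩, rfl⟩
  have hp : (p : ℚ) = 2 * n + 1 := by rw [hn]; push_cast; rfl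
  have hp₀ : (p : ℚ) ≠ 0 := by rw [hp]; positivity
  have c₁ := choose_eq_prod (2 * n) n
  have c₂ := centralBinom_eq_prod_one_sub n
  have h4 : (4 : ℚ) ^ n = 1 + p * q := by
    rw [← hq, hn, Nat.add_sub_cancel, pow_mul]
    norm_num
  rw [← Nat.centralBinom_eq_two_mul_choose] at c₁
  push_cast at c₁ c₂ h₁ h₂ hs
  simp only [one_mul] at h₁
  rw [← hp, h₁, hs, ← hH] at c₁
  rw [ht] at h₂
  rw [← hp, ← one_div, h₂, hs, h4, ← hH] at c₂
  have hsign : ((-1 : ℚ) ^ n) ≠ 0 := by simp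
  have e := c₁.symm.trans c₂
  rw [mul_assoc] at e
  have e := mul_left_cancel₀ hsign e
  rw [← hH]
  obtain ⟨u, hu⟩ : ∃ u : ratPadicInt p,
      (H : ℚ) = -2 * q + p * (q * H + 3 / 4 * H ^ 2) + p ^ 2 * u := by
    refine ⟨2 * (r₁ - t * s - (r₂ - t ^ 3 * s) - q * (t ^ 3 * (H ^ 2 - p * s) + p * r₂)), ?_⟩
    apply mul_left_cancel₀ hp₀
    push_cast
    rw [ht]
    linear_combination -2 * e
  obtain ⟨w, hw⟩ : ∃ w : ratPadicInt p, (H : ℚ) = -2 * q + p * w := by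
    refine ⟨q * H + 3 * t ^ 2 * H ^ 2 + p * u, ?_⟩
    push_cast
    rw [ht]
    linear_combination hu
  constructor
  · refine ⟨u + q * w + 3 * t ^ 2 * (-4 * q * w + p * w ^ 2), ?_⟩
    push_cast
    rw [ht]
    linear_combination hu + p * (q + 3 / 4 * (H + (-2 * q + p * w))) * hw
  · refine ⟨-w + t * (H ^ 2 - p * s) + p * r₁, ?_⟩
    rw [c₁]
    congr 1
    push_cast
    rw [ht]
    linear_combination -p * hw

/-- Lemma 2.3 (Mao): for any prime `p > 3`,
`2^{(9p-9)/2} ∑_{k=0}^{(p-3)/2} C((p-1)/2,2k) C(2k,k) H_k / 4^k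
  ≡ -3(-1)^{(p-1)/2} (2 q_p(2) + 11p q_p(2)²) (mod p²)`,
where `H_k` is the `k`-th harmonic number and `q_p(2) = (2^{p-1}-1)/p`. -/
theorem pow_mul_sum_choose_harmonic_congr (p : ℕ) (hp : p.Prime) (hp3 : 3 < p) :
    ((p : ℤ)) ^ 2 ∣
      (2 ^ ((9 * p - 9) / 2) *
          (∑ k ∈ Finset.range ((p - 3) / 2 + 1),
            (((p - 1) / 2).choose (2 * k) : ℚ) * ((2 * k).choose k : ℚ) * harmonic k / 4 ^ k) -
        (-3) * (-1) ^ ((p - 1) / 2) *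
          (2 * ((2 ^ (p - 1) - 1) / (p : ℚ)) +
            11 * (p : ℚ) * ((2 ^ (p - 1) - 1) / (p : ℚ)) ^ 2)).num := by
  have : Fact p.Prime := ⟨hp⟩
  obtain ⟨n, hn⟩ : ∃ n, p = 2 * n + 1 := hp.odd_of_ne_two (by omega)
  have h2 : 2 ≤ n := by omega
  obtain ⟨q, hq⟩ := exists_two_pow_eq (p := p) (by omega)
  obtain ⟨⟨v, hv⟩, z, hz⟩ := exists_harmonic_eq_and_centralBinom_eq hn h2 q hq
  obtain ⟨w, hw⟩ := exists_harmonic_two_mul_eq hn h2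
  have hp₀ : (p : ℚ) ≠ 0 := by exact_mod_cast hp.ne_zero
  have hsum : ∑ k ∈ Finset.range n,
      (n.choose (2 * k) : ℚ) * ((2 * k).choose k : ℚ) * harmonic k / 4 ^ k =
        n.centralBinom / 2 ^ n * (3 * harmonic n - 2 * harmonic (2 * n)) := by
    rw [← sum_trinomialTerm_mul_harmonic n n (by omega)]
    refine Finset.sum_congr rfl fun k _ => ?_
    rw [trinomialTerm, div_mul_eq_mul_div]
  have hpow : (2 : ℚ) ^ (9 * n) = (1 + p * q) ^ 4 * 2 ^ n := by
    rw [← hq, ← pow_mul, ← pow_add]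
    congr 1
    omega
  have hq' : ((2 : ℚ) ^ (p - 1) - 1) / p = q := by
    rw [hq]
    field_simp
    ring
  have e₁ : (p - 3) / 2 + 1 = n := by omega
  have e₂ : (p - 1) / 2 = n := by omega
  have e₃ : (9 * p - 9) / 2 = 9 * n := by omega
  have e₄ : (2 : ℚ) ^ n ≠ 0 := by positivity
  rw [e₁, e₂, e₃, hq', hsum, hpow, hz, hv, hw]
  let a : ratPadicInt p := 6 * q ^ 2 + 4 * p * q ^ 3 + p ^ 2 * q ^ 4
  let b : ratPadicInt p := 8 * q ^ 2 + z + 4 * p * q * z + a + 2 * p * q * a + p ^ 2 * a * z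
  let d : ratPadicInt p := 3 * v - 2 * w
  refine pow_dvd_num_of_eq_mul 2 ((-1) ^ n *
    (d + 18 * q ^ 3 + 6 * p * q * d + b * (-6 * q + 3 * p * q ^ 2 + p ^ 2 * d))) ?_
  simp only [a, b, d]
  push_cast
  field_simp
  ring
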